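/- arXiv:2408.00383 — 10 statements merged into one kernel-verified Lean document; each statement's English description precedes it below -/
import Mathlib

section
/- Let K be a field and let f₁, f₂, u : ℤ → K with f₁, f₂, T_D(f₁)(f₂) and T_D(f₂)(f₁) nowhere vanishing. Then for all n ∈ ℤ: T_D(T_D(f₁)(f₂))( T_D(f₁)(u) )(n) = T_D(T_D(f₂)(f₁))( T_D(f₂)(u) )(n). (Commutation of two elementary Darboux transformations of type D: T_D(f₂^{1})T_D(f₁) = T_D(f₁^{1})T_D(f₂), where f^{1} denotes the image of f under the first transformation.) -/
/-- The Darboux transformation operator `T_D(f) = f^{[1]}·Δ·f^{−1}` acting on functions: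
`T_D(f)(u)(n) = f(n+1)·( u(n+1)/f(n+1) − u(n)/f(n) )`. -/
def TD {K : Type*} [Field K] (f u : ℤ → K) : ℤ → K :=
  fun n => f (n + 1) * (u (n + 1) / f (n + 1) - u n / f n)

theorem TD_eq_div {K : Type*} [Field K] {f : ℤ → K} (hf : ∀ n, f n ≠ 0) (u : ℤ → K) (n : ℤ) :
    TD f u n = (u (n + 1) * f n - f (n + 1) * u n) / f n := by
  have h := hf n
  have h' := hf (n + 1)
  simp only [TD]
  field_simp

/-- commutation of two elementary Darboux transformations of type D:
`T_D(f₂^{1})·T_D(f₁) = T_D(f₁^{1})·T_D(f₂)` where `f^{1}` is the image of `f` under the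
first transformation. -/
theorem stmt1 {K : Type*} [Field K] (f₁ f₂ u : ℤ → K)
    (h1 : ∀ n, f₁ n ≠ 0) (h2 : ∀ n, f₂ n ≠ 0)
    (h12 : ∀ n, TD f₁ f₂ n ≠ 0) (h21 : ∀ n, TD f₂ f₁ n ≠ 0) (n : ℤ) :
    TD (TD f₁ f₂) (TD f₁ u) n = TD (TD f₂ f₁) (TD f₂ u) n := by
  have wronskian_ne (m : ℤ) : f₂ (m + 1) * f₁ m - f₁ (m + 1) * f₂ m ≠ 0 := by
    have h := h12 m
    rw [TD_eq_div h1] at h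
    exact (div_ne_zero_iff.mp h).1
  have TD_swap (m : ℤ) :
      TD f₂ f₁ m = -(f₂ (m + 1) * f₁ m - f₁ (m + 1) * f₂ m) / f₂ m := by
    rw [TD_eq_div h2]
    ring
  rw [TD_eq_div h12, TD_eq_div h21]
  simp only [TD_swap, TD_eq_div h1, TD_eq_div h2]
  have a0 := h1 n
  have a1 := h1 (n + 1)
  have b0 := h2 n
  have b1 := h2 (n + 1)
  have w0 := wronskian_ne n
  generalize hw : f₂ (n + 1) * f₁ n - f₁ (n + 1) * f₂ n = w at *
  field_simp
  rw [← hw]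
  ring
end

section
/- Let K be a field, g₁, g₂, u : ℤ → K with g₁, g₂ nowhere vanishing, and let P₁, P₂ : ℤ → K satisfy Δ(P_i) = g_i·u (antiderivatives realizing Δ^{−1}(g_i u)). Define G₂(n) = g₁(n−1)·( g₂(n−1)/g₁(n−1) − g₂(n)/g₁(n) ) (this is (T_I^{−1}(g₁))*(g₂)) and symmetrically G₁(n) = g₂(n−1)·( g₁(n−1)/g₂(n−1) − g₁(n)/g₂(n) ), and assume G₁, G₂ are nowhere vanishing. Then: (a) Δ( P₂ − (g₂/g₁)^{[−1]}·P₁ )(n) = G₂(n)·P₁(n)/g₁(n−1) for all n, so P₂ − (g₂/g₁)^{[−1]}P₁ is an antiderivative of G₂·T_I(g₁)(u); and (b) for all n, ( P₂(n) − (g₂(n−1)/g₁(n−1))·P₁(n) )/G₂(n−1) = ( P₁(n) − (g₁(n−1)/g₂(n−1))·P₂(n) )/G₁(n−1). Statement (b) is the commutation relation T_I(g₂^{1})T_I(g₁)(u) = T_I(g₁^{1})T_I(g₂)(u) of two elementary Darboux transformations of type I. -/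
/-- commutation of two elementary Darboux transformations of type I.
With `Δ(P_i) = g_i·u`, `G₂ = (T_I^{−1}(g₁))*(g₂)` and `G₁ = (T_I^{−1}(g₂))*(g₁)`:
(a) `Δ(P₂ − (g₂/g₁)^{[−1]}·P₁)(n) = G₂(n)·P₁(n)/g₁(n−1)`; and
(b) `(P₂ − (g₂/g₁)^{[−1]}P₁)/G₂^{[−1]} = (P₁ − (g₁/g₂)^{[−1]}P₂)/G₁^{[−1]}`. -/
theorem stmt2 {K : Type*} [Field K] (g₁ g₂ u P₁ P₂ : ℤ → K)
    (hg₁ : ∀ n, g₁ n ≠ 0) (hg₂ : ∀ n, g₂ n ≠ 0)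
    (hP₁ : ∀ n, P₁ (n + 1) - P₁ n = g₁ n * u n)
    (hP₂ : ∀ n, P₂ (n + 1) - P₂ n = g₂ n * u n)
    (G₁ G₂ : ℤ → K)
    (hG₂def : ∀ n, G₂ n = g₁ (n - 1) * (g₂ (n - 1) / g₁ (n - 1) - g₂ n / g₁ n))
    (hG₁def : ∀ n, G₁ n = g₂ (n - 1) * (g₁ (n - 1) / g₂ (n - 1) - g₁ n / g₂ n))
    (hG₁ : ∀ n, G₁ n ≠ 0) (hG₂ : ∀ n, G₂ n ≠ 0) :
    (∀ n : ℤ, (P₂ (n + 1) - g₂ n / g₁ n * P₁ (n + 1))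
        - (P₂ n - g₂ (n - 1) / g₁ (n - 1) * P₁ n) = G₂ n * P₁ n / g₁ (n - 1)) ∧
    (∀ n : ℤ, (P₂ n - g₂ (n - 1) / g₁ (n - 1) * P₁ n) / G₂ (n - 1)
        = (P₁ n - g₁ (n - 1) / g₂ (n - 1) * P₂ n) / G₁ (n - 1)) := by
  refine ⟨fun n => ?_, fun n => ?_⟩
  · have h₁ := hg₁ n
    have h₂ := hg₁ (n - 1)
    rw [eq_add_of_sub_eq (hP₁ n), eq_add_of_sub_eq (hP₂ n), hG₂def n]
    field_simp
    ring
  · have h₁ := hg₁ (n - 1)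
    have h₂ := hg₂ (n - 1)
    have h₃ := hg₁ (n - 1 - 1)
    have h₄ := hg₂ (n - 1 - 1)
    rw [div_eq_div_iff (hG₂ _) (hG₁ _), hG₁def, hG₂def]
    field_simp
    ring
end

section
/- Let K be a field, f, g, u : ℤ → K with f, g nowhere vanishing, let Σ : ℤ → K be nowhere vanishing with Δ(Σ) = f·g, and let P : ℤ → K satisfy Δ(P) = g·u. Define f¹(n) = Σ(n)/g(n−1) (this is T_I(g)(f)) and g¹(n) = −Σ(n+1)/f(n+1) (this is (T_D^{−1}(f))*(g)). Then: (a) Δ( P − Σ·u/f )(n) = g¹(n)·T_D(f)(u)(n) for all n, so P − Σ·u/f is an antiderivative of g¹·T_D(f)(u); and (b) for all n, ( P(n) − Σ(n)·u(n)/f(n) )/g¹(n−1) = T_D(f¹)( P/g^{[−1]} )(n), and both sides equal u(n) − f(n)·P(n)/Σ(n). Statement (b) is the mixed commutation relation T_I(g^{1})T_D(f)(u) = T_D(f^{1})T_I(g)(u) of elementary Darboux transformations. -/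
/-- the mixed commutation relation `T_I(g^{1})T_D(f)(u) = T_D(f^{1})T_I(g)(u)`,
with `f¹ = T_I(g)(f)`, `g¹ = (T_D^{−1}(f))*(g)`, `ΔΣ = f·g`, `ΔP = g·u`:
(a) `P − Σ·u/f` is an antiderivative of `g¹·T_D(f)(u)`, and
(b) `(P − Σ·u/f)/g¹^{[−1]} = T_D(f¹)(P/g^{[−1]})`, both sides equal `u − f·P/Σ`. -/
theorem stmt3 {K : Type*} [Field K] (f g u P S : ℤ → K)
    (hf : ∀ n, f n ≠ 0) (hg : ∀ n, g n ≠ 0) (hS0 : ∀ n, S n ≠ 0)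
    (hS : ∀ n, S (n + 1) - S n = f n * g n)
    (hP : ∀ n, P (n + 1) - P n = g n * u n)
    (f1 g1 : ℤ → K)
    (hf1 : ∀ n, f1 n = S n / g (n - 1))
    (hg1 : ∀ n, g1 n = -S (n + 1) / f (n + 1)) :
    (∀ n : ℤ, (P (n + 1) - S (n + 1) * u (n + 1) / f (n + 1))
        - (P n - S n * u n / f n) = g1 n * TD f u n) ∧
    (∀ n : ℤ, (P n - S n * u n / f n) / g1 (n - 1)
          = TD f1 (fun k => P k / g (k - 1)) n ∧
        TD f1 (fun k => P k / g (k - 1)) n = u n - f n * P n / S n) := by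
  have hTD : ∀ n : ℤ, TD f1 (fun k => P k / g (k - 1)) n = u n - f n * P n / S n := by
    intro n
    have hfn := hf n
    have hgn := hg n
    have hgp := hg (n - 1)
    have hSn := hS0 n
    have hSs := hS0 (n + 1)
    have hS' : S (n + 1) = S n + f n * g n := by linear_combination hS n
    have hP' : P (n + 1) = P n + g n * u n := by linear_combination hP n
    simp only [TD, hf1, add_sub_cancel_right]
    rw [div_div_div_cancel_right₀ hgn, div_div_div_cancel_right₀ hgp]
    field_simp
    rw [hS', hP']
    ring
  refine ⟨fun n => ?_, fun n => ⟨?_, hTD n⟩⟩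
  · have hfn := hf n
    have hfs := hf (n + 1)
    simp only [TD, hg1]
    field_simp
    linear_combination f n * f (n + 1) * hP n - f (n + 1) * u n * hS n
  · have hfn := hf n
    have hSn := hS0 n
    rw [hTD n, hg1, sub_add_cancel]
    field_simp
    ring
end

section
/- Let R be a commutative ring, N ≥ 1, and let a₀, …, a_N, f, u : ℤ → R. Define Q(n) = Σ_{i=0}^{N} Σ_{j=1}^{i} f(n−j)·a_i(n−j)·u(n+i−j). Then for all n ∈ ℤ: Δ(Q)(n) = f(n)·( Σ_{i=0}^{N} a_i(n)·u(n+i) ) − ( Σ_{i=0}^{N} a_i(n−i)·f(n−i) )·u(n). Consequently, if Δ(P) = A*(f)·u where A*(f)(n) = Σ_{i=0}^{N} a_i(n−i)·f(n−i), then P + Q is an antiderivative of f·A(u), and Q is a difference operator of orders 0 through N−1 applied to u. (This is the operator identity (Δ^{−1} f A_{≥0})_{<0} = Δ^{−1}·A*_{≥0}(f).) -/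
theorem Finset.sum_Icc_one_telescope {R : Type*} [CommRing R] (G : ℤ → R) (i : ℕ) :
    ∑ j ∈ Finset.Icc 1 i, G ((j : ℤ) - 1) - ∑ j ∈ Finset.Icc 1 i, G j = G 0 - G i := by
  induction i with
  | zero => simp
  | succ k ih =>
    rw [Finset.sum_Icc_succ_top (by omega), Finset.sum_Icc_succ_top (by omega)]
    have h : ((k + 1 : ℕ) : ℤ) - 1 = k := by push_cast; ring
    rw [h]
    linear_combination ih

/-- the operator identity `(Δ^{−1} f A_{≥0})_{<0} = Δ^{−1}·A*_{≥0}(f)`.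
With `Q(n) = Σ_{i=0}^{N} Σ_{j=1}^{i} f(n−j)·a_i(n−j)·u(n+i−j)` one has
`Δ(Q)(n) = f(n)·A(u)(n) − A*(f)(n)·u(n)`; consequently if `ΔP = A*(f)·u` then
`P + Q` is an antiderivative of `f·A(u)`. -/
theorem stmt5 {R : Type*} [CommRing R] (N : ℕ) (hN : 1 ≤ N) (a : ℕ → ℤ → R)
    (f u : ℤ → R) (Q : ℤ → R)
    (hQ : ∀ n : ℤ, Q n = ∑ i ∈ Finset.range (N + 1), ∑ j ∈ Finset.Icc 1 i,
        f (n - j) * a i (n - j) * u (n + i - j)) :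
    (∀ n : ℤ, Q (n + 1) - Q n
        = f n * (∑ i ∈ Finset.range (N + 1), a i n * u (n + i))
          - (∑ i ∈ Finset.range (N + 1), a i (n - i) * f (n - i)) * u n) ∧
    (∀ P : ℤ → R,
      (∀ n : ℤ, P (n + 1) - P n
          = (∑ i ∈ Finset.range (N + 1), a i (n - i) * f (n - i)) * u n) →
      ∀ n : ℤ, (P (n + 1) + Q (n + 1)) - (P n + Q n)
          = f n * ∑ i ∈ Finset.range (N + 1), a i n * u (n + i)) := by
  have hΔ : ∀ n : ℤ, Q (n + 1) - Q n
      = f n * (∑ i ∈ Finset.range (N + 1), a i n * u (n + i))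
        - (∑ i ∈ Finset.range (N + 1), a i (n - i) * f (n - i)) * u n := by
    intro n
    rw [hQ, hQ, Finset.mul_sum, Finset.sum_mul, ← Finset.sum_sub_distrib,
      ← Finset.sum_sub_distrib]
    refine Finset.sum_congr rfl fun i _ => ?_
    have h := Finset.sum_Icc_one_telescope
      (fun k : ℤ => f (n - k) * a i (n - k) * u (n + i - k)) i
    have hshift : ∀ j : ℕ, f (n + 1 - j) * a i (n + 1 - j) * u (n + 1 + i - j)
        = f (n - ((j : ℤ) - 1)) * a i (n - ((j : ℤ) - 1)) * u (n + i - ((j : ℤ) - 1)) := by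
      intro j
      rw [show n - ((j : ℤ) - 1) = n + 1 - j by ring,
        show n + (i : ℤ) - ((j : ℤ) - 1) = n + 1 + i - j by ring]
    simp only [sub_zero, add_sub_cancel_right] at h
    simp only [hshift]
    rw [h]
    ring
  refine ⟨hΔ, fun P hP n => ?_⟩
  linear_combination hP n + hΔ n
end

section
/- Let f₁, g₁, f₂, g₂, u : ℤ → ℝ and assume that for every n ∈ ℤ the families (g₁(m)f₂(m))_{m<n}, (g₂(m)u(m))_{m<n}, and (Σ(m+1)g₂(m)u(m))_{m<n} are absolutely summable, where Σ(n) := Σ_{m<n} g₁(m)f₂(m). Define the operators X_i = f_i·Δ^{−1}·g_i by X_i(v)(n) = f_i(n)·Σ_{m<n} g_i(m)v(m), and define X₂*(g₁)(n) := −g₂(n)·Σ_{m≤n} f₂(m)g₁(m) (the adjoint (Δ^{−1})* = −Σ_{i≥0} Λ^{−i} applied inside X₂* = g₂·(Δ^{−1})*·f₂). Then the family (g₁(m)f₂(m)·Σ_{m'<m}g₂(m')u(m'))_{m<n} is also summable for every n, and for all n ∈ ℤ: X₁(X₂(u))(n) = X₁(f₂)(n)·Σ_{m<n} g₂(m)u(m)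 + f₁(n)·Σ_{m<n} X₂*(g₁)(m)·u(m). (This is the product formula X₁·X₂ = X₁(f₂)·Δ^{−1}·g₂ + f₁·Δ^{−1}·X₂*(g₁) for operators of the form X_i = f_iΔ^{−1}g_i, with Δ^{−1} realized as summation Σ_{m<n}.) -/
/-- `Δ^{−1}` realized as summation: `dsum h n = Σ_{m<n} h(m)`. -/
noncomputable def dsum (h : ℤ → ℝ) (n : ℤ) : ℝ := ∑' m : {m : ℤ // m < n}, h m

/-- The operator `X = f·Δ^{−1}·g`: `X(v)(n) = f(n)·Σ_{m<n} g(m)v(m)`. -/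
noncomputable def Xop (f g v : ℤ → ℝ) : ℤ → ℝ := fun n => f n * dsum (fun m => g m * v m) n

/-- The adjoint `X₂* = g₂·(Δ^{−1})*·f₂` applied to `g₁`:
`X₂*(g₁)(n) = −g₂(n)·Σ_{m≤n} f₂(m)g₁(m)`. -/
noncomputable def Xadj (f₂ g₂ g₁ : ℤ → ℝ) : ℤ → ℝ :=
  fun n => -(g₂ n) * ∑' m : {m : ℤ // m ≤ n}, f₂ m * g₁ m

/-- Enumerate the integers below `n` downwards. -/
def natEquivLt (n : ℤ) : ℕ ≃ {m : ℤ // m < n} where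
  toFun k := ⟨n - 1 - k, by omega⟩
  invFun m := (n - 1 - m.1).toNat
  left_inv k := by simp
  right_inv m := by
    have := m.2
    ext
    simp only
    omega

theorem summable_lt_iff (h : ℤ → ℝ) (n : ℤ) :
    Summable (fun m : {m : ℤ // m < n} => h m) ↔ Summable (fun k : ℕ => h (n - 1 - k)) :=
  (natEquivLt n).summable_iff.symm

theorem dsum_eq_tsum_nat (h : ℤ → ℝ) (n : ℤ) : dsum h n = ∑' k : ℕ, h (n - 1 - k) :=
  ((natEquivLt n).tsum_eq (fun m : {m : ℤ // m < n} => h m)).symm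

theorem tendsto_dsum_sub_nat (h : ℤ → ℝ) (n : ℤ) :
    Filter.Tendsto (fun N : ℕ => dsum h (n - N)) Filter.atTop (nhds 0) := by
  refine (tendsto_sum_nat_add (fun k : ℕ => h (n - 1 - k))).congr fun N => ?_
  rw [dsum_eq_tsum_nat]
  refine tsum_congr fun k => congrArg h ?_
  push_cast
  ring

theorem dsum_add_one (h : ℤ → ℝ) (n : ℤ)
    (hs : Summable (fun m : {m : ℤ // m < n + 1} => h m)) :
    dsum h (n + 1) = dsum h n + h n := by
  rw [summable_lt_iff] at hs
  rw [dsum_eq_tsum_nat, dsum_eq_tsum_nat, hs.tsum_eq_zero_add, add_comm]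
  congr 1
  · refine tsum_congr fun k => congrArg h ?_
    push_cast
    ring
  · simp

/-- Telescoping: `Δ^{−1}Δ F = F` when `F` vanishes at `-∞`. -/
theorem dsum_eq_of_telescope (c F : ℤ → ℝ) (n : ℤ)
    (hs : Summable (fun m : {m : ℤ // m < n} => c m))
    (hc : ∀ m, c m = F (m + 1) - F m)
    (hF : Filter.Tendsto (fun N : ℕ => F (n - N)) Filter.atTop (nhds 0)) :
    dsum c n = F n := by
  rw [summable_lt_iff] at hs
  rw [dsum_eq_tsum_nat]
  refine tendsto_nhds_unique hs.hasSum.tendsto_sum_nat ?_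
  have partial_sum : ∀ N : ℕ, ∑ k ∈ Finset.range N, c (n - 1 - k) = F n - F (n - N) := by
    intro N
    induction N with
    | zero => simp
    | succ N ih =>
      rw [Finset.sum_range_succ, ih, hc]
      have e1 : n - 1 - (N : ℤ) + 1 = n - N := by ring
      have e2 : n - ((N + 1 : ℕ) : ℤ) = n - 1 - N := by push_cast; ring
      rw [e1, e2]
      ring
  simp only [partial_sum]
  simpa using hF.const_sub (F n)

theorem summable_mul_dsum (a b : ℤ → ℝ) (n : ℤ)
    (ha : Summable (fun m : {m : ℤ // m < n} => a m)) :
    Summable (fun m : {m : ℤ // m < n} => a m * dsum b m) := by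
  rw [summable_lt_iff] at ha
  rw [summable_lt_iff (fun m => a m * dsum b m)]
  refine summable_of_isBigO_nat ha.norm ?_
  have hb := (tendsto_dsum_sub_nat b (n - 1)).isBigO_one ℝ
  simpa using (Asymptotics.isBigO_refl (fun k : ℕ => a (n - 1 - k)) Filter.atTop).norm_right.mul hb

/-- Summation by parts. -/
theorem dsum_mul_dsum (a b : ℤ → ℝ)
    (ha : ∀ n : ℤ, Summable (fun m : {m : ℤ // m < n} => a m))
    (hb : ∀ n : ℤ, Summable (fun m : {m : ℤ // m < n} => b m)) (n : ℤ)
    (hab : Summable (fun m : {m : ℤ // m < n} => dsum a ((m : ℤ) + 1) * b m)) :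
    dsum (fun m => a m * dsum b m) n + dsum (fun m => dsum a (m + 1) * b m) n
      = dsum a n * dsum b n := by
  have hs := summable_mul_dsum a b n (ha n)
  rw [← dsum_eq_of_telescope (fun m => a m * dsum b m + dsum a (m + 1) * b m)
    (fun m => dsum a m * dsum b m) n (hs.add hab) ?_ ?_]
  · exact (hs.tsum_add hab).symm
  · intro m
    simp only [dsum_add_one a m (ha _), dsum_add_one b m (hb _)]
    ring
  · simpa using (tendsto_dsum_sub_nat a n).mul (tendsto_dsum_sub_nat b n)

theorem Xadj_eq (f₂ g₂ g₁ : ℤ → ℝ) (n : ℤ) :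
    Xadj f₂ g₂ g₁ n = -(g₂ n) * dsum (fun k => g₁ k * f₂ k) (n + 1) := by
  unfold Xadj dsum
  congr 1
  rw [← (Equiv.subtypeEquivRight fun m : ℤ => Int.lt_add_one_iff (a := m) (b := n)).tsum_eq]
  exact tsum_congr fun m => mul_comm _ _

/-- the product formula
`X₁·X₂ = X₁(f₂)·Δ^{−1}·g₂ + f₁·Δ^{−1}·X₂*(g₁)` for operators `X_i = f_iΔ^{−1}g_i`. -/
theorem stmt6 (f₁ g₁ f₂ g₂ u : ℤ → ℝ)
    (h1 : ∀ n : ℤ, Summable (fun m : {m : ℤ // m < n} => g₁ m * f₂ m))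
    (h2 : ∀ n : ℤ, Summable (fun m : {m : ℤ // m < n} => g₂ m * u m))
    (h3 : ∀ n : ℤ, Summable (fun m : {m : ℤ // m < n} =>
        dsum (fun k => g₁ k * f₂ k) ((m : ℤ) + 1) * (g₂ m * u m))) :
    (∀ n : ℤ, Summable (fun m : {m : ℤ // m < n} =>
        g₁ m * f₂ m * dsum (fun k => g₂ k * u k) m)) ∧
    (∀ n : ℤ, Xop f₁ g₁ (Xop f₂ g₂ u) n
        = Xop f₁ g₁ f₂ n * dsum (fun k => g₂ k * u k) n
          + f₁ n * dsum (fun k => Xadj f₂ g₂ g₁ k * u k) n) := by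
  refine ⟨fun n => summable_mul_dsum (fun k => g₁ k * f₂ k) _ n (h1 n), fun n => ?_⟩
  have parts := dsum_mul_dsum (fun k => g₁ k * f₂ k) (fun k => g₂ k * u k) h1 h2 n (h3 n)
  have hadj : dsum (fun k => Xadj f₂ g₂ g₁ k * u k) n
      = -dsum (fun m => dsum (fun k => g₁ k * f₂ k) (m + 1) * (g₂ m * u m)) n := by
    conv_rhs => rw [dsum, ← tsum_neg]
    refine tsum_congr fun m => ?_
    simp only [Xadj_eq]
    ring
  rw [hadj]
  simp only [Xop, ← mul_assoc] at parts ⊢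
  linear_combination f₁ n * parts
end

section
/- Let K be a field, m ≤ N integers, f : ℤ → K nowhere vanishing, and a_m, …, a_N : ℤ → K. Let A(u)(n) = Σ_{i=m}^{N} a_i(n)·u(n+i). Then there exist functions c_m, …, c_N : ℤ → K such that for every u : ℤ → K and every P : ℤ → K with Δ(P)(n) = u(n)/f(n+1) (so that T_D^{−1}(f)(u) = f·P), one has for all n ∈ ℤ: T_D(f)( A(f·P) )(n) = Σ_{j=m}^{N} c_j(n)·u(n+j) + T_D(f)(A(f))(n)·P(n+m). (This is the identity (T_D(f)·A_{≥m}·T_D^{−1}(f))_{<m} = (T_D(f)·A_{≥m})(f)·Λ^m·Δ^{−1}·(f^{[1]})^{−1} of Lemma 4.1: the conjugate of A by T_D(f) equals a difference operator of orders m through N plus the rank-one tail with generating functions T_D(f)(A(f)) and (f^{[1]})^{−1}.) -/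
/-- Telescoping a discrete antiderivative, with the summation range padded to `[m, N]`. -/
theorem eq_add_sum_Icc_ite {M : Type*} [AddCommGroup M] (m N : ℤ) (P g : ℤ → M)
    (hP : ∀ n, P (n + 1) - P n = g n) (n k : ℤ) (hmk : m ≤ k) (hkN : k ≤ N + 1) :
    P (n + k) = P (n + m) + ∑ j ∈ Finset.Icc m N, if j < k then g (n + j) else 0 := by
  induction k, hmk using Int.leInduction with
  | base =>
    rw [Finset.sum_eq_zero, add_zero]
    intro j hj
    rw [if_neg (not_lt.mpr (Finset.mem_Icc.mp hj).1)]
  | succ k hmk ih =>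
    have hsplit : ∀ j, (if j < k + 1 then g (n + j) else 0)
        = (if j < k then g (n + j) else 0) + if k = j then g (n + j) else 0 := by
      intro j
      rcases lt_trichotomy j k with h | h | h
      · simp [h, h.ne', show j < k + 1 by lia]
      · simp [h]
      · simp [h.not_gt, h.ne, show ¬ j < k + 1 by lia]
    have hk : k ∈ Finset.Icc m N := Finset.mem_Icc.mpr ⟨hmk, by lia⟩
    simp_rw [hsplit]
    rw [Finset.sum_add_distrib, Finset.sum_ite_eq, if_pos hk, ← add_assoc (P _),
      ← ih (by lia), ← hP, ← add_assoc n, add_sub_cancel]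

/-- the identity
`(T_D(f)·A_{≥m}·T_D^{−1}(f))_{<m} = (T_D(f)·A_{≥m})(f)·Λ^m·Δ^{−1}·(f^{[1]})^{−1}`:
the conjugate of `A` by `T_D(f)` equals a difference operator of orders `m` through `N`
plus the rank-one tail with generating functions `T_D(f)(A(f))` and `(f^{[1]})^{−1}`. -/
theorem stmt7 {K : Type*} [Field K] (m N : ℤ) (hmN : m ≤ N) (f : ℤ → K)
    (hf : ∀ n, f n ≠ 0) (a : ℤ → ℤ → K) :
    ∃ c : ℤ → ℤ → K, ∀ u P : ℤ → K,
      (∀ n : ℤ, P (n + 1) - P n = u n / f (n + 1)) →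
      ∀ n : ℤ,
        TD f (fun k => ∑ i ∈ Finset.Icc m N, a i k * (f (k + i) * P (k + i))) n
          = (∑ j ∈ Finset.Icc m N, c j n * u (n + j))
            + TD f (fun k => ∑ i ∈ Finset.Icc m N, a i k * f (k + i)) n * P (n + m) := by
  refine ⟨fun j n => ∑ i ∈ Finset.Icc m N,
    (a i (n + 1) * f (n + 1 + i) * (if j < i + 1 then 1 else 0)
      - f (n + 1) / f n * (a i n * f (n + i)) * (if j < i then 1 else 0)) / f (n + j + 1), ?_⟩
  intro u P hP n
  have hTD : ∀ v : ℤ → K, TD f v n = v (n + 1) - f (n + 1) / f n * v n := by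
    intro v
    have h₀ := hf n
    have h₁ := hf (n + 1)
    simp only [TD]
    field_simp
  rw [hTD, hTD]
  simp_rw [Finset.mul_sum, Finset.sum_mul]
  rw [Finset.sum_comm, ← Finset.sum_sub_distrib, ← Finset.sum_sub_distrib, Finset.sum_mul,
    ← Finset.sum_add_distrib]
  refine Finset.sum_congr rfl fun i hi => ?_
  obtain ⟨hmi, hiN⟩ := Finset.mem_Icc.mp hi
  have tel := eq_add_sum_Icc_ite m N P (fun n => u n / f (n + 1)) hP n
  rw [show P (n + 1 + i) = P (n + (i + 1)) by congr 1; ring, tel i hmi (by lia),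
    tel (i + 1) (by lia) (by lia)]
  have hsum : ∀ x y : K,
      ∑ j ∈ Finset.Icc m N, (x * (if j < i + 1 then 1 else 0) - y * (if j < i then 1 else 0))
          / f (n + j + 1) * u (n + j)
        = x * (∑ j ∈ Finset.Icc m N, if j < i + 1 then u (n + j) / f (n + j + 1) else 0)
          - y * ∑ j ∈ Finset.Icc m N, if j < i then u (n + j) / f (n + j + 1) else 0 := by
    intro x y
    rw [Finset.mul_sum, Finset.mul_sum, ← Finset.sum_sub_distrib]
    refine Finset.sum_congr rfl fun j _ => ?_
    split_ifs <;> ring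
  rw [hsum]
  ring
end

section
/- Let K be a field, m ≤ N integers, g : ℤ → K nowhere vanishing, and a_m, …, a_N : ℤ → K. Let A(u)(n) = Σ_{i=m}^{N} a_i(n)·u(n+i), let T_I^{−1}(g)(u)(n) = u(n+1) − (g(n−1)/g(n))·u(n), and let w := (T_I^{−1}(g))*(A*(g)), i.e. w(n) = g(n−1)·( h(n−1)/g(n−1) − h(n)/g(n) ) with h(n) = A*(g)(n) = Σ_{i=m}^{N} a_i(n−i)·g(n−i). Then there exist functions c_m, …, c_N : ℤ → K such that for every u : ℤ → K and every Q : ℤ → K with Δ(Q) = g·A(T_I^{−1}(g)(u)), there exists P : ℤ → K with Δ(P) = w·u and, for all n ∈ ℤ: Q(n)/g(n−1) = Σ_{j=m}^{N} c_j(n)·u(n+j) + P(n+m)/g(n−1). (This is the identity (T_I(g)·A_{≥m}·T_I^{−1}(g))_{<m} = (g^{[−1]})^{−1}·Λ^m·Δ^{−1}·(A_{≥m}·T_I^{−1}(g))*(g) of Lemma 4.2.) -/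
theorem Int.sum_Icc_eq_add_sum_Icc_add_one {M : Type*} [AddCommMonoid M] (f : ℤ → M) {a b : ℤ}
    (hab : a ≤ b) : ∑ i ∈ Finset.Icc a b, f i = f a + ∑ i ∈ Finset.Icc (a + 1) b, f i := by
  rw [← Finset.insert_Icc_add_one_left_eq_Icc hab, Finset.sum_insert (by simp)]

theorem Int.sum_Icc_sub_add_one {M : Type*} [AddCommGroup M] (f : ℤ → M) {a b : ℤ}
    (hab : a ≤ b) : ∑ i ∈ Finset.Icc a b, (f i - f (i + 1)) = f a - f (b + 1) := by
  induction b, hab using Int.leInduction with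
  | base => simp
  | succ b hb ih =>
    rw [← Finset.insert_Icc_right_eq_Icc_add_one (by lia), Finset.sum_insert (by simp), ih]
    abel


/-- the identity
`(T_I(g)·A_{≥m}·T_I^{−1}(g))_{<m} = (g^{[−1]})^{−1}·Λ^m·Δ^{−1}·(A_{≥m}·T_I^{−1}(g))*(g)`:
with `w = (T_I^{−1}(g))*(A*(g))`, the conjugate of `A` by `T_I(g)` equals a difference
operator of orders `m` through `N` plus the rank-one tail. -/
theorem stmt8 {K : Type*} [Field K] (m N : ℤ) (hmN : m ≤ N) (g : ℤ → K)
    (hg : ∀ n, g n ≠ 0) (a : ℤ → ℤ → K) (w : ℤ → K)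
    (hw : ∀ n : ℤ, w n = g (n - 1) *
        ((∑ i ∈ Finset.Icc m N, a i (n - 1 - i) * g (n - 1 - i)) / g (n - 1)
          - (∑ i ∈ Finset.Icc m N, a i (n - i) * g (n - i)) / g n)) :
    ∃ c : ℤ → ℤ → K, ∀ u Q : ℤ → K,
      (∀ n : ℤ, Q (n + 1) - Q n = g n * ∑ i ∈ Finset.Icc m N, a i n *
          (u (n + i + 1) - g (n + i - 1) / g (n + i) * u (n + i))) →
      ∃ P : ℤ → K, (∀ n : ℤ, P (n + 1) - P n = w n * u n) ∧
        ∀ n : ℤ, Q n / g (n - 1)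
          = (∑ j ∈ Finset.Icc m N, c j n * u (n + j)) + P (n + m) / g (n - 1) := by
  set G : ℤ → ℤ → K := fun j k => ∑ i ∈ Finset.Icc j N, a i (k - i) * g (k - i) with hG
  have hG_step : ∀ j k, j ≤ N → G j k = a j (k - j) * g (k - j) + G (j + 1) k :=
    fun j k hj => Int.sum_Icc_eq_add_sum_Icc_add_one _ hj
  have hG_top : ∀ k, G (N + 1) k = 0 := fun k => by simp [hG]
  have hw_eq : ∀ k, w k = G m (k - 1) - G m k * (g (k - 1) / g k) := by
    intro k
    have h₁ := hg (k - 1)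
    have h₂ := hg k
    rw [hw k]
    change g (k - 1) * (G m (k - 1) / g (k - 1) - G m k / g k) = _
    field_simp
  let e : ℤ → ℤ → K := fun j n => G j (n + j - 1) - G (j + 1) (n + j) * (g (n + j - 1) / g (n + j))
  refine ⟨fun j n => e j n / g (n - 1), fun u Q hQ => ?_⟩
  set E : ℤ → K := fun n => ∑ j ∈ Finset.Icc m N, e j n * u (n + j) with hE
  have hE_step : ∀ n, Q (n + 1) - Q n - (E (n + 1) - E n) = w (n + m) * u (n + m) := by
    intro n
    let φ : ℤ → K := fun j =>
      (G j (n + j - 1) - G j (n + j) * (g (n + j - 1) / g (n + j))) * u (n + j)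
    have hφ : ∑ j ∈ Finset.Icc m N, (φ j - φ (j + 1)) = w (n + m) * u (n + m) := by
      rw [Int.sum_Icc_sub_add_one φ hmN, hw_eq]
      simp [φ, hG_top]
    rw [← hφ, hQ, hE, Finset.mul_sum, ← Finset.sum_sub_distrib, ← Finset.sum_sub_distrib]
    refine Finset.sum_congr rfl fun j hj => ?_
    have h := hG_step j (n + j) (Finset.mem_Icc.mp hj).2
    rw [add_sub_cancel_right] at h
    have h₁ : n + 1 + j = n + j + 1 := by ring
    simp only [e, φ, h₁, ← add_assoc, add_sub_cancel_right]
    linear_combination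
      -(u (n + j + 1) - g (n + j - 1) / g (n + j) * u (n + j)) * h
  refine ⟨fun n => Q (n - m) - E (n - m), fun n => ?_, fun n => ?_⟩
  · have h := hE_step (n - m)
    rw [sub_add_cancel, sub_add_eq_add_sub] at h
    rw [← h]
    ring
  · have h : ∑ j ∈ Finset.Icc m N, e j n / g (n - 1) * u (n + j) = E n / g (n - 1) := by
      rw [hE, Finset.sum_div]
      exact Finset.sum_congr rfl fun j _ => div_mul_eq_mul_div _ _ _
    simp only [h, add_sub_cancel_right]
    ring
end

section
/- Let K be a field, f₁, g : ℤ → K nowhere vanishing, and let Σ : ℤ → K be nowhere vanishing with Δ(Σ) = f₁·g. Define G(n) = −Σ(n+1)/f₁(n+1) (this is the transformed adjoint eigenfunction G = (T_D^{−1}(f₁))*(g)). Then for all n ∈ ℤ: G(n−1)·( 1/(f₁(n)·G(n−1)) − 1/(f₁(n+1)·G(n)) ) = g(n)/Σ(n+1). Since T_I(g)(f₁)(n) = Σ(n)/g(n−1), the left-hand side is (T_I^{−1}(G))*((f₁^{[1]})^{−1})(n) and the right-hand side is ( (T_I(g)(f₁))^{[1]}(n) )^{−1}; this is the second identity of Lemma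 5.1. -/
/-- the second identity of Lemma 5.1:
`(T_I^{−1}(G))*((f₁^{[1]})^{−1}) = ((T_I(g)(f₁))^{[1]})^{−1}` where
`G = (T_D^{−1}(f₁))*(g)`, i.e. `G(n) = −Σ(n+1)/f₁(n+1)` with `ΔΣ = f₁·g`. -/
theorem stmt11 {K : Type*} [Field K] (f₁ g S : ℤ → K)
    (hf₁ : ∀ n, f₁ n ≠ 0) (hg : ∀ n, g n ≠ 0) (hS0 : ∀ n, S n ≠ 0)
    (hS : ∀ n, S (n + 1) - S n = f₁ n * g n)
    (G : ℤ → K) (hG : ∀ n, G n = -S (n + 1) / f₁ (n + 1)) :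
    ∀ n : ℤ, G (n - 1) * (1 / (f₁ n * G (n - 1)) - 1 / (f₁ (n + 1) * G n))
      = g n / S (n + 1) := by
  intro n
  have hf := hf₁ n
  have hf' := hf₁ (n + 1)
  have hSn := hS0 n
  have hSn' := hS0 (n + 1)
  rw [hG (n - 1), hG n, sub_add_cancel]
  field_simp
  linear_combination hS n
end

section
/- Let K be a field, f, g₁ : ℤ → K nowhere vanishing, and let Σ : ℤ → K be nowhere vanishing with Δ(Σ) = g₁·f. Define F(n) = Σ(n)/g₁(n−1) (this is the transformed eigenfunction F = T_I(g₁)(f)), and assume F is nowhere vanishing. Then for all n ∈ ℤ: T_D(F)( (g₁^{[−1]})^{−1} )(n) = −f(n)/Σ(n). Since (T_D^{−1}(f))*(g₁)(n) = −Σ(n+1)/f(n+1), the right-hand side equals ( ((T_D^{−1}(f))*(g₁))^{[−1]}(n) )^{−1}; this is the third identity of Lemma 5.1: applying T_D of the once-transformed f to the eigenfunction (g₁^{[−1]})^{−1} created by T_I(g₁) yields the reciprocal of the shifted transformed adjoint eigenfunction. -/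
/-- the third identity of Lemma 5.1: with `F = T_I(g₁)(f)`, i.e.
`F(n) = Σ(n)/g₁(n−1)` where `ΔΣ = g₁·f`, applying `T_D(F)` to the eigenfunction
`(g₁^{[−1]})^{−1}` yields `−f/Σ = (((T_D^{−1}(f))*(g₁))^{[−1]})^{−1}`. -/
theorem stmt12 {K : Type*} [Field K] (f g₁ S : ℤ → K)
    (hf : ∀ n, f n ≠ 0) (hg₁ : ∀ n, g₁ n ≠ 0) (hS0 : ∀ n, S n ≠ 0)
    (hS : ∀ n, S (n + 1) - S n = g₁ n * f n)
    (F : ℤ → K) (hF : ∀ n, F n = S n / g₁ (n - 1)) (hF0 : ∀ n, F n ≠ 0) :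
    ∀ n : ℤ, TD F (fun k => (g₁ (k - 1))⁻¹) n = -f n / S n := by
  intro n
  have hg := hg₁ n
  have hg' := hg₁ (n - 1)
  have h0 := hS0 n
  have h1 := hS0 (n + 1)
  have hn := hS n
  simp only [TD, hF, add_sub_cancel_right]
  field_simp
  linear_combination -hn
end

section
/- Define q, r, u₀ : ℤ × ℝ² → ℝ by q(n,t₁,t₂) = 4·6^n·e^{6t₁+14t₂} / ( 6^n·e^{5t₁+13t₂} + 2^n·e^{3t₁+5t₂} + 4·3^n·e^{4t₁+10t₂} ), r(n,t₁,t₂) = ( 3^{n+1}·e^{4t₂} + 2^{n+1}·e^{−t₁−t₂} + e^{−2t₁−4t₂} ) / ( 6^{n+1}·e^{2t₁+8t₂} + 4·3^{n+1}·e^{t₁+5t₂} + 2^{n+1} ), and u₀(n,t₁,t₂) = 2·( 2·72^n·e^{4t₁+16t₂} + 4·18^n·e^{2t₁+10t₂} + 2·24^n·e^{2t₁+8t₂} + 12·54^n·e^{4t₁+18t₂} + 12^n·e^{t₁+5t₂} + 3·108^n·e^{5t₁+21t₂} + 12·36^n·e^{3t₁+13t₂} ) / ( ( 3·6^n·e^{2t₁+8t₂}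 + 6·3^n·e^{t₁+5t₂} + 2^n )·( 6^n·e^{2t₁+8t₂} + 4·3^n·e^{t₁+5t₂} + 2^n )² ). Then all denominators are nonzero, and (q, r, u₀) satisfies the t₁-flow of the (1,0,1)-gcdKP hierarchy: for all (n,t₁,t₂), ∂_{t₁}u₀ = q^{[1]}·r − q·r^{[−1]}, ∂_{t₁}q = q^{[1]} + u₀·q, and ∂_{t₁}r = −r^{[−1]} − u₀·r. -/
open Real

/-- The solution `q` of the (1,0,1)-gcdKP hierarchy from the paper's Example. -/
noncomputable def qSol (n : ℤ) (t₁ t₂ : ℝ) : ℝ :=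
  4 * (6 : ℝ) ^ n * exp (6 * t₁ + 14 * t₂) /
    ((6 : ℝ) ^ n * exp (5 * t₁ + 13 * t₂) + (2 : ℝ) ^ n * exp (3 * t₁ + 5 * t₂)
      + 4 * (3 : ℝ) ^ n * exp (4 * t₁ + 10 * t₂))

/-- The solution `r` of the (1,0,1)-gcdKP hierarchy from the paper's Example. -/
noncomputable def rSol (n : ℤ) (t₁ t₂ : ℝ) : ℝ :=
  ((3 : ℝ) ^ (n + 1) * exp (4 * t₂) + (2 : ℝ) ^ (n + 1) * exp (-t₁ - t₂)
      + exp (-2 * t₁ - 4 * t₂)) /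
    ((6 : ℝ) ^ (n + 1) * exp (2 * t₁ + 8 * t₂) + 4 * (3 : ℝ) ^ (n + 1) * exp (t₁ + 5 * t₂)
      + (2 : ℝ) ^ (n + 1))

/-- The solution `u₀` of the (1,0,1)-gcdKP hierarchy from the paper's Example. -/
noncomputable def u0Sol (n : ℤ) (t₁ t₂ : ℝ) : ℝ :=
  2 * (2 * (72 : ℝ) ^ n * exp (4 * t₁ + 16 * t₂) + 4 * (18 : ℝ) ^ n * exp (2 * t₁ + 10 * t₂)
      + 2 * (24 : ℝ) ^ n * exp (2 * t₁ + 8 * t₂) + 12 * (54 : ℝ) ^ n * exp (4 * t₁ + 18 * t₂)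
      + (12 : ℝ) ^ n * exp (t₁ + 5 * t₂) + 3 * (108 : ℝ) ^ n * exp (5 * t₁ + 21 * t₂)
      + 12 * (36 : ℝ) ^ n * exp (3 * t₁ + 13 * t₂)) /
    ((3 * (6 : ℝ) ^ n * exp (2 * t₁ + 8 * t₂) + 6 * (3 : ℝ) ^ n * exp (t₁ + 5 * t₂)
        + (2 : ℝ) ^ n)
      * ((6 : ℝ) ^ n * exp (2 * t₁ + 8 * t₂) + 4 * (3 : ℝ) ^ n * exp (t₁ + 5 * t₂)
        + (2 : ℝ) ^ n) ^ 2)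

lemma qSol_eq (n : ℤ) (t₁ t₂ : ℝ) :
    qSol n t₁ t₂ = 4 * ((2 : ℝ) ^ n * (3 : ℝ) ^ n) * exp t₁ ^ 3 * exp t₂ ^ 9 /
      ((2 : ℝ) ^ n * (3 : ℝ) ^ n * exp t₁ ^ 2 * exp t₂ ^ 8 + 4 * (3 : ℝ) ^ n * exp t₁ * exp t₂ ^ 5
        + (2 : ℝ) ^ n) := by
  have h6 : (6 : ℝ) ^ n = (2 : ℝ) ^ n * (3 : ℝ) ^ n := by rw [← mul_zpow]; norm_num
  have h₁ : exp (6 * t₁ + 14 * t₂) = exp t₁ ^ 6 * exp t₂ ^ 14 := by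
    simp only [exp_add, ← exp_nat_mul, Nat.cast_ofNat]
  have h₂ : exp (5 * t₁ + 13 * t₂) = exp t₁ ^ 5 * exp t₂ ^ 13 := by
    simp only [exp_add, ← exp_nat_mul, Nat.cast_ofNat]
  have h₃ : exp (3 * t₁ + 5 * t₂) = exp t₁ ^ 3 * exp t₂ ^ 5 := by
    simp only [exp_add, ← exp_nat_mul, Nat.cast_ofNat]
  have h₄ : exp (4 * t₁ + 10 * t₂) = exp t₁ ^ 4 * exp t₂ ^ 10 := by
    simp only [exp_add, ← exp_nat_mul, Nat.cast_ofNat]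
  have ha : (0 : ℝ) < 2 ^ n := by positivity
  have hb : (0 : ℝ) < 3 ^ n := by positivity
  have hE := exp_pos t₁
  have hF := exp_pos t₂
  rw [qSol, h6, h₁, h₂, h₃, h₄, div_eq_div_iff (by positivity) (by positivity)]
  ring

lemma rSol_eq (n : ℤ) (t₁ t₂ : ℝ) :
    rSol n t₁ t₂ = (3 * (3 : ℝ) ^ n * exp t₁ ^ 2 * exp t₂ ^ 8 + 2 * (2 : ℝ) ^ n * exp t₁ * exp t₂ ^ 3
        + 1) /
      (2 * (exp t₁ ^ 2 * exp t₂ ^ 4) * (3 * ((2 : ℝ) ^ n * (3 : ℝ) ^ n) * exp t₁ ^ 2 * exp t₂ ^ 8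
        + 6 * (3 : ℝ) ^ n * exp t₁ * exp t₂ ^ 5 + (2 : ℝ) ^ n)) := by
  have h6 : (6 : ℝ) ^ n = (2 : ℝ) ^ n * (3 : ℝ) ^ n := by rw [← mul_zpow]; norm_num
  have h₁ : exp (4 * t₂) = exp t₂ ^ 4 := by
    simp only [← exp_nat_mul, Nat.cast_ofNat]
  have h₂ : exp (-t₁ - t₂) = (exp t₁ * exp t₂)⁻¹ := by
    rw [← exp_add, ← exp_neg]; congr 1; ring
  have h₃ : exp (-2 * t₁ - 4 * t₂) = (exp t₁ ^ 2 * exp t₂ ^ 4)⁻¹ := by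
    simp only [← exp_nat_mul, Nat.cast_ofNat]
    rw [← exp_add, ← exp_neg]; congr 1; ring
  have h₄ : exp (2 * t₁ + 8 * t₂) = exp t₁ ^ 2 * exp t₂ ^ 8 := by
    simp only [exp_add, ← exp_nat_mul, Nat.cast_ofNat]
  have h₅ : exp (t₁ + 5 * t₂) = exp t₁ * exp t₂ ^ 5 := by
    simp only [exp_add, ← exp_nat_mul, Nat.cast_ofNat]
  have ha : (0 : ℝ) < 2 ^ n := by positivity
  have hb : (0 : ℝ) < 3 ^ n := by positivity
  have hE := exp_pos t₁
  have hF := exp_pos t₂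
  rw [rSol, h₁, h₂, h₃, h₄, h₅, zpow_add_one₀ (by norm_num), zpow_add_one₀ (by norm_num),
    zpow_add_one₀ (by norm_num), h6, div_eq_div_iff (by positivity) (by positivity)]
  field_simp
  ring

lemma rSol_sub_one_eq (n : ℤ) (t₁ t₂ : ℝ) :
    rSol (n - 1) t₁ t₂ = ((3 : ℝ) ^ n * exp t₁ ^ 2 * exp t₂ ^ 8 + (2 : ℝ) ^ n * exp t₁ * exp t₂ ^ 3
        + 1) /
      (exp t₁ ^ 2 * exp t₂ ^ 4 * ((2 : ℝ) ^ n * (3 : ℝ) ^ n * exp t₁ ^ 2 * exp t₂ ^ 8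
        + 4 * (3 : ℝ) ^ n * exp t₁ * exp t₂ ^ 5 + (2 : ℝ) ^ n)) := by
  rw [rSol_eq, zpow_sub_one₀ (by norm_num), zpow_sub_one₀ (by norm_num)]
  have ha : (0 : ℝ) < 2 ^ n := by positivity
  have hb : (0 : ℝ) < 3 ^ n := by positivity
  have hE := exp_pos t₁
  have hF := exp_pos t₂
  rw [div_eq_div_iff (by positivity) (by positivity)]
  ring

lemma qSol_add_one_eq (n : ℤ) (t₁ t₂ : ℝ) :
    qSol (n + 1) t₁ t₂ = 12 * ((2 : ℝ) ^ n * (3 : ℝ) ^ n) * exp t₁ ^ 3 * exp t₂ ^ 9 /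
      (3 * ((2 : ℝ) ^ n * (3 : ℝ) ^ n) * exp t₁ ^ 2 * exp t₂ ^ 8
        + 6 * (3 : ℝ) ^ n * exp t₁ * exp t₂ ^ 5 + (2 : ℝ) ^ n) := by
  rw [qSol_eq, zpow_add_one₀ (by norm_num), zpow_add_one₀ (by norm_num)]
  have ha : (0 : ℝ) < 2 ^ n := by positivity
  have hb : (0 : ℝ) < 3 ^ n := by positivity
  have hE := exp_pos t₁
  have hF := exp_pos t₂
  rw [div_eq_div_iff (by positivity) (by positivity)]
  ring

lemma u0Sol_eq (n : ℤ) (t₁ t₂ : ℝ) :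
    u0Sol n t₁ t₂ = 2 * ((2 : ℝ) ^ n * (3 : ℝ) ^ n * exp t₁ * exp t₂ ^ 5) *
        (2 * ((2 : ℝ) ^ n) ^ 2 * (3 : ℝ) ^ n * exp t₁ ^ 3 * exp t₂ ^ 11
          + 4 * (3 : ℝ) ^ n * exp t₁ * exp t₂ ^ 5 + 2 * ((2 : ℝ) ^ n) ^ 2 * exp t₁ * exp t₂ ^ 3
          + 12 * ((3 : ℝ) ^ n) ^ 2 * exp t₁ ^ 3 * exp t₂ ^ 13 + (2 : ℝ) ^ n
          + 3 * (2 : ℝ) ^ n * ((3 : ℝ) ^ n) ^ 2 * exp t₁ ^ 4 * exp t₂ ^ 16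
          + 12 * ((2 : ℝ) ^ n * (3 : ℝ) ^ n) * exp t₁ ^ 2 * exp t₂ ^ 8) /
      ((3 * ((2 : ℝ) ^ n * (3 : ℝ) ^ n) * exp t₁ ^ 2 * exp t₂ ^ 8
          + 6 * (3 : ℝ) ^ n * exp t₁ * exp t₂ ^ 5 + (2 : ℝ) ^ n)
        * ((2 : ℝ) ^ n * (3 : ℝ) ^ n * exp t₁ ^ 2 * exp t₂ ^ 8
          + 4 * (3 : ℝ) ^ n * exp t₁ * exp t₂ ^ 5 + (2 : ℝ) ^ n) ^ 2) := by
  have hz (i j : ℕ) : ((2 : ℝ) ^ i * 3 ^ j) ^ n = ((2 : ℝ) ^ n) ^ i * ((3 : ℝ) ^ n) ^ j := by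
    rw [mul_zpow, ← zpow_natCast, ← zpow_natCast, ← zpow_natCast, ← zpow_natCast,
      zpow_comm, zpow_comm 3]
  have he (i j : ℕ) : exp (i * t₁ + j * t₂) = exp t₁ ^ i * exp t₂ ^ j := by
    simp only [exp_add, exp_nat_mul]
  have h6 := hz 1 1
  have h12 := hz 2 1
  have h18 := hz 1 2
  have h24 := hz 3 1
  have h36 := hz 2 2
  have h54 := hz 1 3
  have h72 := hz 3 2
  have h108 := hz 2 3
  have e₁ := he 4 16
  have e₂ := he 2 10
  have e₃ := he 2 8
  have e₄ := he 4 18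
  have e₅ := he 1 5
  have e₆ := he 5 21
  have e₇ := he 3 13
  norm_num at h6 h12 h18 h24 h36 h54 h72 h108 e₁ e₂ e₃ e₄ e₅ e₆ e₇
  rw [u0Sol, h6, h12, h18, h24, h36, h54, h72, h108, e₁, e₂, e₃, e₄, e₅, e₆, e₇]
  congr 1 <;> ring

lemma hasDerivAt_const_mul_exp_pow_mul (c d : ℝ) (k : ℕ) (t : ℝ) :
    HasDerivAt (fun s => c * exp s ^ k * d) (k * (c * exp t ^ k * d)) t := by
  have h := (((hasDerivAt_exp t).pow k).const_mul c).mul_const d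
  refine h.congr_deriv ?_
  cases k with
  | zero => simp
  | succ k => simp only [Nat.add_sub_cancel]; ring

lemma hasDerivAt_const_mul_exp_mul (c d : ℝ) (t : ℝ) :
    HasDerivAt (fun s => c * exp s * d) (c * exp t * d) t :=
  ((hasDerivAt_exp t).const_mul c).mul_const d

/-- all denominators are nonzero and `(q, r, u₀)` satisfies the `t₁`-flow of
the (1,0,1)-gcdKP hierarchy: `∂_{t₁}u₀ = q^{[1]}r − qr^{[−1]}`, `∂_{t₁}q = q^{[1]} + u₀q`,
`∂_{t₁}r = −r^{[−1]} − u₀r`. -/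
theorem stmt16 :
    (∀ (n : ℤ) (t₁ t₂ : ℝ),
      (6 : ℝ) ^ n * exp (5 * t₁ + 13 * t₂) + (2 : ℝ) ^ n * exp (3 * t₁ + 5 * t₂)
        + 4 * (3 : ℝ) ^ n * exp (4 * t₁ + 10 * t₂) ≠ 0) ∧
    (∀ (n : ℤ) (t₁ t₂ : ℝ),
      (6 : ℝ) ^ (n + 1) * exp (2 * t₁ + 8 * t₂) + 4 * (3 : ℝ) ^ (n + 1) * exp (t₁ + 5 * t₂)
        + (2 : ℝ) ^ (n + 1) ≠ 0) ∧
    (∀ (n : ℤ) (t₁ t₂ : ℝ),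
      (3 * (6 : ℝ) ^ n * exp (2 * t₁ + 8 * t₂) + 6 * (3 : ℝ) ^ n * exp (t₁ + 5 * t₂)
          + (2 : ℝ) ^ n)
        * ((6 : ℝ) ^ n * exp (2 * t₁ + 8 * t₂) + 4 * (3 : ℝ) ^ n * exp (t₁ + 5 * t₂)
          + (2 : ℝ) ^ n) ^ 2 ≠ 0) ∧
    (∀ (n : ℤ) (t₁ t₂ : ℝ),
      HasDerivAt (fun s => u0Sol n s t₂)
        (qSol (n + 1) t₁ t₂ * rSol n t₁ t₂ - qSol n t₁ t₂ * rSol (n - 1) t₁ t₂) t₁ ∧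
      HasDerivAt (fun s => qSol n s t₂)
        (qSol (n + 1) t₁ t₂ + u0Sol n t₁ t₂ * qSol n t₁ t₂) t₁ ∧
      HasDerivAt (fun s => rSol n s t₂)
        (-rSol (n - 1) t₁ t₂ - u0Sol n t₁ t₂ * rSol n t₁ t₂) t₁) := by
  refine ⟨fun n t₁ t₂ => by positivity, fun n t₁ t₂ => by positivity,
    fun n t₁ t₂ => by positivity, fun n t₁ t₂ => ?_⟩
  simp only [qSol_add_one_eq, rSol_sub_one_eq]
  simp only [qSol_eq, rSol_eq, u0Sol_eq]
  have ha : (0 : ℝ) < 2 ^ n := by positivity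
  have hb : (0 : ℝ) < 3 ^ n := by positivity
  have hF := exp_pos t₂
  have hE := exp_pos t₁
  generalize (2 : ℝ) ^ n = a at *
  generalize (3 : ℝ) ^ n = b at *
  generalize exp t₂ = F at *
  have hP : HasDerivAt (fun s => a * b * exp s ^ 2 * F ^ 8 + 4 * b * exp s * F ^ 5 + a)
      (2 * (a * b * exp t₁ ^ 2 * F ^ 8) + 4 * b * exp t₁ * F ^ 5) t₁ :=
    ((hasDerivAt_const_mul_exp_pow_mul (a * b) (F ^ 8) 2 t₁).add
      (hasDerivAt_const_mul_exp_mul (4 * b) (F ^ 5) t₁)).add_const a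
  have hR : HasDerivAt (fun s => 3 * (a * b) * exp s ^ 2 * F ^ 8 + 6 * b * exp s * F ^ 5 + a)
      (2 * (3 * (a * b) * exp t₁ ^ 2 * F ^ 8) + 6 * b * exp t₁ * F ^ 5) t₁ :=
    ((hasDerivAt_const_mul_exp_pow_mul (3 * (a * b)) (F ^ 8) 2 t₁).add
      (hasDerivAt_const_mul_exp_mul (6 * b) (F ^ 5) t₁)).add_const a
  refine ⟨?_, ?_, ?_⟩
  · have hN := (((((((hasDerivAt_const_mul_exp_pow_mul (2 * a ^ 2 * b) (F ^ 11) 3 t₁).add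
      (hasDerivAt_const_mul_exp_mul (4 * b) (F ^ 5) t₁)).add
      (hasDerivAt_const_mul_exp_mul (2 * a ^ 2) (F ^ 3) t₁)).add
      (hasDerivAt_const_mul_exp_pow_mul (12 * b ^ 2) (F ^ 13) 3 t₁)).add_const a).add
      (hasDerivAt_const_mul_exp_pow_mul (3 * a * b ^ 2) (F ^ 16) 4 t₁)).add
      (hasDerivAt_const_mul_exp_pow_mul (12 * (a * b)) (F ^ 8) 2 t₁))
    have hM := ((hasDerivAt_const_mul_exp_mul (a * b) (F ^ 5) t₁).const_mul 2).mul hN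
    refine (hM.div (hR.mul (hP.pow 2))
      (by simp only [Pi.mul_apply, Pi.pow_apply]; positivity)).congr_deriv ?_
    simp only [Pi.mul_apply, Pi.pow_apply, Pi.add_apply]
    generalize exp t₁ = E at *
    field_simp
    push_cast
    ring
  · refine ((hasDerivAt_const_mul_exp_pow_mul (4 * (a * b)) (F ^ 9) 3 t₁).div hP
      (by positivity)).congr_deriv ?_
    generalize exp t₁ = E at *
    field_simp
    push_cast
    ring
  · refine (((hasDerivAt_const_mul_exp_pow_mul (3 * b) (F ^ 8) 2 t₁).add
      (hasDerivAt_const_mul_exp_mul (2 * a) (F ^ 3) t₁)).add_const 1 |>.div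
      ((((hasDerivAt_exp t₁).pow 2).mul_const (F ^ 4)).const_mul 2 |>.mul hR)
      (by simp only [Pi.mul_apply, Pi.pow_apply]; positivity)).congr_deriv ?_
    simp only [Pi.mul_apply, Pi.pow_apply, Pi.add_apply]
    generalize exp t₁ = E at *
    field_simp
    push_cast
    ring
end
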